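/- Let s = Σᵢ bᵢBᵢ ∈ S₃²(Δ_{WS₃}) with domain points ξᵢ and basis condition number κ_∞(B). Then for each i, |bᵢ − s(ξᵢ)| ≤ 2 κ_∞(B) h² max_{α+β=2} ‖D_x^α D_y^β s‖_∞, where h is the length of the longest edge of Δ. -/

import Mathlib

open MeasureTheory

/-- The plane `ℝ²` as a Euclidean space. -/
abbrev V2 := EuclideanSpace ℝ (Fin 2)

/-- The (closed) triangle with vertices `p 0, p 1, p 2`. -/
def tri (p : Fin 3 → V2) : Set V2 := convexHull ℝ (Set.range p)

/-- The `3·3 = 9` boundary points of the WS₃ split: the vertices together with the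
trisection points of the edges. -/
def wsPts (p : Fin 3 → V2) : Set V2 :=
  {x | ∃ i j : Fin 3, ∃ k : Fin 4,
    x = ((k : ℝ) / 3) • p i + (1 - (k : ℝ) / 3) • p j}

/-- The union of all the lines of the complete graph on the 9 boundary points of the
WS₃ split. -/
def cutLines (p : Fin 3 → V2) : Set V2 :=
  {x | ∃ a ∈ wsPts p, ∃ b ∈ wsPts p, a ≠ b ∧
    x ∈ (affineSpan ℝ ({a, b} : Set V2) : Set V2)}

/-- `g` is (the restriction of) a bivariate polynomial of total degree at most `d`. -/
def IsPolyDeg (d : ℕ) (g : V2 → ℝ) : Prop :=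
  ∃ q : MvPolynomial (Fin 2) ℝ, q.totalDegree ≤ d ∧
    ∀ z : V2, g z = MvPolynomial.eval (fun i => z i) q

/-- The spline space `S₃²(Δ_{WS₃})`: functions (extended by zero outside `Δ`) that are
`C²` on the triangle `Δ` and coincide with a cubic polynomial on every open region of
the WS₃ split (the connected components of the interior of `Δ` minus the complete
graph of lines through the 9 boundary points). -/
def splineSpace (p : Fin 3 → V2) : Set (V2 → ℝ) :=
  {f | ContDiffOn ℝ 2 f (tri p) ∧
    (∀ x ∈ interior (tri p) \ cutLines p,
      ∃ g, IsPolyDeg 3 g ∧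
        Set.EqOn f g (connectedComponentIn (interior (tri p) \ cutLines p) x)) ∧
    ∀ x ∉ tri p, f x = 0}

/-- The 28 relative scaling weights of the simplex spline basis on the WS₃ split. -/
noncomputable def wvec : Fin 28 → ℝ :=
  ![1/6, 1/6, 1/6, 1/3, 1/3, 1/3, 1/3, 1/3, 1/3, 1/2, 1/2, 1/2, 1/2, 1/2, 1/2,
    2/3, 2/3, 2/3, 5/6, 5/6, 5/6, 2/3, 2/3, 2/3, 2/3, 2/3, 2/3, 1]

/-- Barycentric coordinates (w.r.t. `Δ`) of the 28 domain points of the simplex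
spline basis (0-indexed; entry `i` corresponds to the paper's `ξ_{i+1}`). -/
noncomputable def bary : Fin 28 → Fin 3 → ℝ :=
  ![![1, 0, 0], ![0, 1, 0], ![0, 0, 1],
    ![8/9, 1/9, 0], ![8/9, 0, 1/9], ![0, 8/9, 1/9],
    ![1/9, 8/9, 0], ![1/9, 0, 8/9], ![0, 1/9, 8/9],
    ![2/3, 1/3, 0], ![2/3, 0, 1/3], ![0, 2/3, 1/3],
    ![1/3, 2/3, 0], ![1/3, 0, 2/3], ![0, 1/3, 2/3],
    ![7/9, 1/9, 1/9], ![1/9, 7/9, 1/9], ![1/9, 1/9, 7/9],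
    ![7/15, 7/15, 1/15], ![1/15, 7/15, 7/15], ![7/15, 1/15, 7/15],
    ![5/9, 1/3, 1/9], ![5/9, 1/9, 1/3], ![1/9, 5/9, 1/3],
    ![1/3, 5/9, 1/9], ![1/3, 1/9, 5/9], ![1/9, 1/3, 5/9],
    ![1/3, 1/3, 1/3]]

/-- The domain points of the simplex spline basis on the triangle `p`. -/
noncomputable def dpt (p : Fin 3 → V2) (i : Fin 28) : V2 :=
  ∑ k : Fin 3, bary i k • p k

/-- The sup-norm of a function over the triangle `p`. -/
noncomputable def supTri (p : Fin 3 → V2) (f : V2 → ℝ) : ℝ :=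
  sSup ((fun x => |f x|) '' tri p)

/-- The standard basis vector `e_i` of `ℝ²`. -/
noncomputable def ee (i : Fin 2) : V2 := EuclideanSpace.single i 1

/-- A triangle has diameter at most the longest edge. -/
theorem tri_dist_le (p : Fin 3 → V2) {x y : V2} (hx : x ∈ tri p) (hy : y ∈ tri p) :
    dist x y ≤ max (dist (p 0) (p 1)) (max (dist (p 1) (p 2)) (dist (p 0) (p 2))) := by
  obtain ⟨x', ⟨i, rfl⟩, y', ⟨j, rfl⟩, H⟩ := convexHull_exists_dist_ge2 hx hy
  refine H.trans ?_
  fin_cases i <;> fin_cases j <;> simp [dist_comm (p 1) (p 0), dist_comm (p 2) (p 0), dist_comm (p 2) (p 1)]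

theorem dpt_mem_tri (p : Fin 3 → V2) (i : Fin 28) : dpt p i ∈ tri p := by
  refine (convex_convexHull ℝ _).sum_mem ?_ ?_ ?_
  · intro k _
    fin_cases i <;> fin_cases k <;> norm_num [bary]
  · fin_cases i <;> simp [bary, Fin.sum_univ_succ] <;> norm_num
  · intro k _
    exact subset_convexHull ℝ _ ⟨k, rfl⟩

theorem tri_uniqueDiffOn (p : Fin 3 → V2) (hp : AffineIndependent ℝ p) :
    UniqueDiffOn ℝ (tri p) := by
  refine uniqueDiffOn_convex (convex_convexHull ℝ _) ?_
  refine interior_convexHull_nonempty_iff_affineSpan_eq_top.2 ?_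
  rw [hp.affineSpan_eq_top_iff_card_eq_finrank_add_one]
  simp

theorem tri_isCompact (p : Fin 3 → V2) : IsCompact (tri p) :=
  (Set.finite_range p).isCompact_convexHull (𝕜 := ℝ)

theorem v2_decomp (u : V2) : u = u 0 • ee 0 + u 1 • ee 1 := by
  ext k
  fin_cases k <;> simp [ee]

theorem abs_add_abs_le (u : V2) : |u 0| + |u 1| ≤ √2 * ‖u‖ := by
  rw [EuclideanSpace.norm_eq, ← Real.sqrt_mul (by norm_num)]
  apply Real.le_sqrt_of_sq_le
  simp only [Fin.sum_univ_two, Real.norm_eq_abs]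
  nlinarith [sq_nonneg (|u 0| - |u 1|)]

theorem bilin_norm_le (T : V2 →L[ℝ] V2 →L[ℝ] ℝ) (M : ℝ) (hM : 0 ≤ M)
    (hT : ∀ u v : Fin 2, |T (ee u) (ee v)| ≤ M) : ‖T‖ ≤ 2 * M := by
  refine T.opNorm_le_bound₂ (by positivity) fun u v => ?_
  have h1 : ‖T u v‖ ≤ M * ((|u 0| + |u 1|) * (|v 0| + |v 1|)) := by
    have e : T u v = u 0 * v 0 * T (ee 0) (ee 0) + u 0 * v 1 * T (ee 0) (ee 1)
        + u 1 * v 0 * T (ee 1) (ee 0) + u 1 * v 1 * T (ee 1) (ee 1) := by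
      conv_lhs => rw [v2_decomp u, v2_decomp v]
      simp only [map_add, map_smul, add_apply,
        smul_apply, smul_eq_mul]
      ring
    have k : ∀ (a b : ℝ) (i j : Fin 2), |a * b * T (ee i) (ee j)| ≤ |a| * |b| * M := by
      intro a b i j
      rw [abs_mul, abs_mul]
      exact mul_le_mul_of_nonneg_left (hT i j) (by positivity)
    rw [e, Real.norm_eq_abs]
    refine (abs_add_le _ _).trans ?_
    refine (add_le_add_left (abs_add_le _ _) _).trans ?_
    refine (add_le_add_left (add_le_add_left (abs_add_le _ _) _) _).trans ?_
    linarith [k (u 0) (v 0) 0 0, k (u 0) (v 1) 0 1, k (u 1) (v 0) 1 0, k (u 1) (v 1) 1 1]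
  refine h1.trans ?_
  have h2 := mul_le_mul (abs_add_abs_le u) (abs_add_abs_le v) (by positivity) (by positivity)
  have h3 : √2 * √2 = 2 := Real.mul_self_sqrt (by norm_num)
  calc M * ((|u 0| + |u 1|) * (|v 0| + |v 1|)) ≤ M * (√2 * ‖u‖ * (√2 * ‖v‖)) :=
        mul_le_mul_of_nonneg_left h2 hM
    _ = (√2 * √2) * M * ‖u‖ * ‖v‖ := by ring
    _ = 2 * M * ‖u‖ * ‖v‖ := by rw [h3]

theorem hess_bound (p : Fin 3 → V2) (hp : AffineIndependent ℝ p) (s : V2 → ℝ)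
    (hs : ContDiffOn ℝ 2 s (tri p)) (x : V2) (hx : x ∈ tri p) (u v : Fin 2) :
    |iteratedFDerivWithin ℝ 2 s (tri p) x ![ee u, ee v]| ≤
      sSup {y : ℝ | ∃ x ∈ tri p, ∃ u v : Fin 2,
        y = |iteratedFDerivWithin ℝ 2 s (tri p) x ![ee u, ee v]|} := by
  apply le_csSup
  · have hc := hs.continuousOn_iteratedFDerivWithin (m := 2) le_rfl (tri_uniqueDiffOn p hp)
    obtain ⟨C, hC⟩ := (tri_isCompact p).exists_bound_of_continuousOn hc
    refine ⟨C, ?_⟩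
    rintro y ⟨z, hz, a, b, rfl⟩
    have := (iteratedFDerivWithin ℝ 2 s (tri p) z).le_opNorm ![ee a, ee b]
    rw [Real.norm_eq_abs] at this
    refine this.trans ?_
    simpa [Fin.prod_univ_two, ee] using hC z hz
  · exact ⟨x, hx, u, v, rfl⟩

theorem taylor_bound (p : Fin 3 → V2) (hp : AffineIndependent ℝ p) (s : V2 → ℝ)
    (hs : ContDiffOn ℝ 2 s (tri p)) (M h : ℝ) (hM0 : 0 ≤ M)
    (hd : ∀ x ∈ tri p, ∀ y ∈ tri p, dist x y ≤ h)
    (hM : ∀ x ∈ tri p, ∀ u v : Fin 2,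
      |iteratedFDerivWithin ℝ 2 s (tri p) x ![ee u, ee v]| ≤ M)
    (ξ x : V2) (hξ : ξ ∈ tri p) (hx : x ∈ tri p) :
    |s x - s ξ - fderivWithin ℝ s (tri p) ξ (x - ξ)| ≤ 2 * M * h ^ 2 := by
  have hU := tri_uniqueDiffOn p hp
  have hconv : Convex ℝ (tri p) := convex_convexHull ℝ _
  have hD1 : DifferentiableOn ℝ s (tri p) := hs.differentiableOn (by norm_num)
  have hD2 : DifferentiableOn ℝ (fderivWithin ℝ s (tri p)) (tri p) :=
    (hs.fderivWithin hU (m := 1) (by norm_num)).differentiableOn (by norm_num)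
  have hb2 : ∀ z ∈ tri p, ‖fderivWithin ℝ (fderivWithin ℝ s (tri p)) (tri p) z‖ ≤ 2 * M := by
    intro z hz
    refine bilin_norm_le _ M hM0 fun u v => ?_
    have := hM z hz u v
    rwa [iteratedFDerivWithin_two_apply s hU hz] at this
  have hh0 : 0 ≤ h := by simpa using hd x hx x hx
  have hb1 : ∀ z ∈ tri p, ‖fderivWithin ℝ s (tri p) z - fderivWithin ℝ s (tri p) ξ‖
      ≤ 2 * M * h := by
    intro z hz
    refine (hconv.norm_image_sub_le_of_norm_fderivWithin_le hD2 hb2 hξ hz).trans ?_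
    rw [← dist_eq_norm]
    exact mul_le_mul_of_nonneg_left (hd z hz ξ hξ) (by positivity)
  have := hconv.norm_image_sub_le_of_norm_fderivWithin_le' hD1 hb1 hξ hx
  rw [Real.norm_eq_abs, ← dist_eq_norm] at this
  refine this.trans ?_
  calc 2 * M * h * dist x ξ ≤ 2 * M * h * h :=
        mul_le_mul_of_nonneg_left (hd x hx ξ hξ) (by positivity)
    _ = 2 * M * h ^ 2 := by ring

/-- for `s = Σᵢ bᵢBᵢ ∈ S₃²(Δ_{WS₃})` with domain points `ξᵢ` and basis
condition number (bound) `κ`, one has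
`|bᵢ − s(ξᵢ)| ≤ 2 κ h² max_{α+β=2} ‖D_x^α D_y^β s‖_∞` for each `i`, where `h` is the
length of the longest edge of `Δ`.  The hypotheses record that the basis is a
partition of unity reproducing affine functions via the domain points, and that `κ`
satisfies the stability inequality defining the condition number. -/
theorem control_point_distance (p : Fin 3 → V2) (hp : AffineIndependent ℝ p)
    (B : Fin 28 → V2 → ℝ)
    (hBS : ∀ i, B i ∈ splineSpace p)
    (hpos : ∀ i, ∀ x ∈ tri p, 0 ≤ B i x)
    (hPU : ∀ x ∈ tri p, ∑ i, B i x = 1)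
    (haff : ∀ (L : V2 →ₗ[ℝ] ℝ) (c : ℝ), ∀ x ∈ tri p,
      ∑ i, (L (dpt p i) + c) * B i x = L x + c)
    (κ : ℝ) (hκpos : 0 < κ)
    (hκ : ∀ b : Fin 28 → ℝ,
      (⨆ i, |b i|) ≤ κ * supTri p (fun x => ∑ i, b i * B i x))
    (b : Fin 28 → ℝ) (s : V2 → ℝ) (hs : s = fun x => ∑ i, b i * B i x)
    (h : ℝ)
    (hh : h = max (dist (p 0) (p 1)) (max (dist (p 1) (p 2)) (dist (p 0) (p 2))))
    (M2 : ℝ)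
    (hM2 : M2 = sSup {y : ℝ | ∃ x ∈ tri p, ∃ u v : Fin 2,
      y = |iteratedFDerivWithin ℝ 2 s (tri p) x ![ee u, ee v]|}) :
    ∀ i, |b i - s (dpt p i)| ≤ 2 * κ * h ^ 2 * M2 := by
  intro i
  have hC : ContDiffOn ℝ 2 s (tri p) := by
    rw [hs]
    exact ContDiffOn.sum fun j _ => contDiffOn_const.mul (hBS j).1
  have hξ := dpt_mem_tri p i
  have hM : ∀ x ∈ tri p, ∀ u v : Fin 2,
      |iteratedFDerivWithin ℝ 2 s (tri p) x ![ee u, ee v]| ≤ M2 := by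
    intro x hx u v
    rw [hM2]
    exact hess_bound p hp s hC x hx u v
  have hM0 : 0 ≤ M2 := (abs_nonneg _).trans (hM _ hξ 0 0)
  have hd : ∀ x ∈ tri p, ∀ y ∈ tri p, dist x y ≤ h := by
    intro x hx y hy
    rw [hh]
    exact tri_dist_le p hx hy
  set D := fderivWithin ℝ s (tri p) (dpt p i) with hDdef
  have key := hκ (fun j => b j - (D (dpt p j) + (s (dpt p i) - D (dpt p i))))
  have h1 := (le_ciSup (Set.finite_range fun j =>
    |b j - (D (dpt p j) + (s (dpt p i) - D (dpt p i)))|).bddAbove i).trans key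
  have h2 : supTri p (fun x => ∑ j,
      (b j - (D (dpt p j) + (s (dpt p i) - D (dpt p i)))) * B j x) ≤ 2 * M2 * h ^ 2 := by
    refine csSup_le ⟨_, _, hξ, rfl⟩ ?_
    rintro _ ⟨x, hx, rfl⟩
    have ht := taylor_bound p hp s hC M2 h hM0 hd hM _ x hξ hx
    rw [← hDdef] at ht
    have ha := haff (D : V2 →ₗ[ℝ] ℝ) (s (dpt p i) - D (dpt p i)) x hx
    simp only [ContinuousLinearMap.coe_coe] at ha
    have hsx : s x = ∑ j, b j * B j x := by rw [hs]
    have e : ∑ j, (b j - (D (dpt p j) + (s (dpt p i) - D (dpt p i)))) * B j x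
        = s x - s (dpt p i) - D (x - dpt p i) := by
      simp only [sub_mul _ _ (B _ x), Finset.sum_sub_distrib]
      rw [ha, ← hsx, map_sub]
      ring
    simp only [e]
    exact ht
  have h3 := h1.trans (mul_le_mul_of_nonneg_left h2 hκpos.le)
  simp only [add_sub_cancel] at h3
  linarith
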